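/- For every point (x;p,q) ∈ 𝓒 one has, in êP(ℂ): [x,p,q] + [1-x,-q,-p] = 2·[1/2,0,0], where (1-x;-q,-p) denotes the corresponding point of 𝓒 over 1-x. -/

import Mathlib

open Complex
open scoped Classical

noncomputable section

namespace ExtendedBloch

/-- `π` as a complex number. -/
def Cpi : ℂ := (Real.pi : ℂ)

/-- Membership in `ℂ ∖ {0,1}`. -/
def Reg (z : ℂ) : Prop := z ≠ 0 ∧ z ≠ 1

/-- The open upper half plane. -/
def UHP : Set ℂ := {z : ℂ | 0 < z.im}

/-- The 5-tuple occurring in the five term relation. -/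
def ftTuple (x y : ℂ) : Fin 5 → ℂ :=
  ![x, y, y / x, (1 - x⁻¹) / (1 - y⁻¹), (1 - x) / (1 - y)]

/-- The set `FT` of five term tuples. -/
def FT : Set (Fin 5 → ℂ) :=
  {v | ∃ x y : ℂ, Reg x ∧ Reg y ∧ x ≠ y ∧ v = ftTuple x y}

/-- The subset `FT⁺` of tuples with all coordinates in the upper half plane. -/
def FTplus : Set (Fin 5 → ℂ) := {v | v ∈ FT ∧ ∀ i, v i ∈ UHP}

/-- The point `(z; p, q)` of the cover `𝓒` of `ℂ ∖ {0,1}`, realized concretely as the pair of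
branch values `(log z + pπi, -log(1-z) + qπi)` (Riemann surface model of `𝓒`). -/
def pt (z : ℂ) (p q : ℤ) : ℂ × ℂ :=
  (Complex.log z + p * (Cpi * I), -Complex.log (1 - z) + q * (Cpi * I))

/-- The cover `𝓒`, realized as the Riemann surface of all branches of
`(log z + pπi, -log(1-z) + qπi)` on `ℂ ∖ {0,1}`. -/
def Cover : Set (ℂ × ℂ) := {w | ∃ z : ℂ, Reg z ∧ ∃ p q : ℤ, w = pt z p q}

lemma pt_mem_Cover {z : ℂ} (h : Reg z) (p q : ℤ) : pt z p q ∈ Cover :=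
  ⟨z, h, p, q, rfl⟩

/-- `w ∈ 𝓒` lies over `z ∈ ℂ ∖ {0,1}`. -/
def LiesOver (w : ℂ × ℂ) (z : ℂ) : Prop := Reg z ∧ ∃ p q : ℤ, w = pt z p q

/-- The covering action of `ℤ × ℤ` on `𝓒`. -/
def covAct (v : ℤ × ℤ) (w : ℂ × ℂ) : ℂ × ℂ :=
  (w.1 + v.1 * (Cpi * I), w.2 + v.2 * (Cpi * I))

/-- The subset `V ⊂ (ℤ × ℤ)⁵`. -/
def Vset : Set (Fin 5 → ℤ × ℤ) :=
  {v | ∃ p₀ p₁ q₀ q₁ q₂ : ℤ,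
    v = ![(p₀, q₀), (p₁, q₁), (p₁ - p₀, q₂), (p₁ - p₀ + q₁ - q₀, q₂ - q₁),
          (q₁ - q₀, q₂ - q₁ - p₀)]}

/-- The preimage of `FT` in `𝓒⁵`. -/
def FTpre : Set (Fin 5 → ℂ × ℂ) := {w | ∃ v ∈ FT, ∀ i, LiesOver (w i) (v i)}

/-- A base point `((x₀;0,0),…,(x₄;0,0))` with `(x₀,…,x₄) ∈ FT⁺`. -/
def basePt : Fin 5 → ℂ × ℂ := fun i => pt (ftTuple ((1 + I) / 4) I i) 0 0

/-- `𝓕𝓣̂₀`: the connected component of the preimage of `FT` in `𝓒⁵` containing the points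
`((x₀;0,0),…,(x₄;0,0))` with `(x₀,…,x₄) ∈ FT⁺`. -/
def FThat₀ : Set (Fin 5 → ℂ × ℂ) := connectedComponentIn FTpre basePt

/-- `𝓕𝓣̂ = 𝓕𝓣̂₀ + V`. -/
def FThat : Set (Fin 5 → ℂ × ℂ) :=
  {u | ∃ w ∈ FThat₀, ∃ v ∈ Vset, u = fun i => covAct (v i) (w i)}

abbrev CoverT : Type := ↥Cover

/-- The generator `(z; p, q)` of the free abelian group on `𝓒`. -/
def genOf (z : ℂ) (h : Reg z) (p q : ℤ) : FreeAbelianGroup CoverT :=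
  FreeAbelianGroup.of ⟨pt z p q, pt_mem_Cover h p q⟩

/-- The lifted five term relators. -/
def FiveTermRels : Set (FreeAbelianGroup CoverT) :=
  {a | ∃ w : Fin 5 → ℂ × ℂ, w ∈ FThat ∧ ∃ hc : ∀ i, w i ∈ Cover,
    a = ∑ i : Fin 5, (-1 : ℤ) ^ (i : ℕ) • FreeAbelianGroup.of (⟨w i, hc i⟩ : CoverT)}

/-- The transfer relators. -/
def TransferRels : Set (FreeAbelianGroup CoverT) :=
  {a | ∃ z : ℂ, ∃ h : Reg z, ∃ p q p' q' : ℤ,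
    a = genOf z h p q + genOf z h p' q' - genOf z h p q' - genOf z h p' q}

def relSub : AddSubgroup (FreeAbelianGroup CoverT) :=
  AddSubgroup.closure (FiveTermRels ∪ TransferRels)

def relSub' : AddSubgroup (FreeAbelianGroup CoverT) :=
  AddSubgroup.closure FiveTermRels

/-- The extended pre-Bloch group `êP(ℂ)`. -/
abbrev EPreBloch : Type := FreeAbelianGroup CoverT ⧸ relSub

/-- The variant `êP'(ℂ)` without the transfer relations. -/
abbrev EPreBloch' : Type := FreeAbelianGroup CoverT ⧸ relSub'

/-- The class `[z, p, q] ∈ êP(ℂ)` (junk value `0` if `z ∈ {0,1}`). -/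
def cls (z : ℂ) (p q : ℤ) : EPreBloch :=
  if h : Reg z then QuotientAddGroup.mk (genOf z h p q) else 0

/-- The class `[z, p, q] ∈ êP'(ℂ)` (junk value `0` if `z ∈ {0,1}`). -/
def cls' (z : ℂ) (p q : ℤ) : EPreBloch' :=
  if h : Reg z then QuotientAddGroup.mk (genOf z h p q) else 0

/-- `ℂ ∧_ℤ ℂ`, the second exterior power of `ℂ` as a `ℤ`-module. -/
abbrev L2C : Type := ↥(⋀[ℤ]^2 ℂ)

/-- The wedge `a ∧ b ∈ ℂ ∧_ℤ ℂ`. -/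
def wedge (a b : ℂ) : L2C :=
  ⟨ExteriorAlgebra.ιMulti ℤ 2 ![a, b],
   ExteriorAlgebra.ιMulti_range ℤ 2 (Set.mem_range_self _)⟩

def nuFree : FreeAbelianGroup CoverT →+ L2C :=
  FreeAbelianGroup.lift fun w : CoverT => wedge w.1.1 w.1.2

/-- The homomorphism `ν : êP(ℂ) → ℂ ∧_ℤ ℂ`. -/
def nuHom : EPreBloch →+ L2C :=
  if h : ∀ a ∈ relSub, nuFree a = 0 then QuotientAddGroup.lift relSub nuFree h else 0

/-- The homomorphism `ν : êP'(ℂ) → ℂ ∧_ℤ ℂ`. -/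
def nuHom' : EPreBloch' →+ L2C :=
  if h : ∀ a ∈ relSub', nuFree a = 0 then QuotientAddGroup.lift relSub' nuFree h else 0

/-- The extended Bloch group `êB(ℂ) = ker ν`. -/
def EBloch : AddSubgroup EPreBloch := nuHom.ker

/-- `êB'(ℂ) = ker ν` on `êP'(ℂ)`. -/
def EBloch' : AddSubgroup EPreBloch' := nuHom'.ker

/-- The component `X₀₀` of `𝓒` (both fiber coordinates even). -/
def X00 : Set (ℂ × ℂ) := {w | ∃ z : ℂ, Reg z ∧ ∃ p q : ℤ, w = pt z (2 * p) (2 * q)}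

abbrev X00T : Type := ↥X00

lemma pt_mem_X00 {z : ℂ} (h : Reg z) (p q : ℤ) : pt z (2 * p) (2 * q) ∈ X00 :=
  ⟨z, h, p, q, rfl⟩

/-- The generator `(z; 2p, 2q)` of the free abelian group on `X₀₀`. -/
def genOf₀ (z : ℂ) (h : Reg z) (p q : ℤ) : FreeAbelianGroup X00T :=
  FreeAbelianGroup.of ⟨pt z (2 * p) (2 * q), pt_mem_X00 h p q⟩

/-- The five term relators coming from `𝓕𝓣̂ ∩ (X₀₀)⁵`. -/
def FiveTermRels₀ : Set (FreeAbelianGroup X00T) :=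
  {a | ∃ w : Fin 5 → ℂ × ℂ, w ∈ FThat ∧ ∃ hc : ∀ i, w i ∈ X00,
    a = ∑ i : Fin 5, (-1 : ℤ) ^ (i : ℕ) • FreeAbelianGroup.of (⟨w i, hc i⟩ : X00T)}

def relSub₀ : AddSubgroup (FreeAbelianGroup X00T) := AddSubgroup.closure FiveTermRels₀

/-- The true extended pre-Bloch group `êêP(ℂ)`. -/
abbrev EEPreBloch : Type := FreeAbelianGroup X00T ⧸ relSub₀

/-- The class `[z, 2p, 2q] ∈ êêP(ℂ)` (junk value `0` if `z ∈ {0,1}`). -/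
def cls₀ (z : ℂ) (p q : ℤ) : EEPreBloch :=
  if h : Reg z then QuotientAddGroup.mk (genOf₀ z h p q) else 0

def nuFree₀ : FreeAbelianGroup X00T →+ L2C :=
  FreeAbelianGroup.lift fun w : X00T => wedge w.1.1 w.1.2

/-- The homomorphism `ν̂ : êêP(ℂ) → ℂ ∧_ℤ ℂ`. -/
def nuHom₀ : EEPreBloch →+ L2C :=
  if h : ∀ a ∈ relSub₀, nuFree₀ a = 0 then QuotientAddGroup.lift relSub₀ nuFree₀ h else 0

/-- The true extended Bloch group `êêB(ℂ) = ker ν̂`. -/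
def EEBloch : AddSubgroup EEPreBloch := nuHom₀.ker

/-- The Rogers dilogarithm `𝓡(z) = ½ log z log(1-z) - ∫₀ᶻ log(1-t)/t dt` (straight segment,
parametrized by `t = s z`). -/
def rogers (z : ℂ) : ℂ :=
  (1 / 2) * Complex.log z * Complex.log (1 - z) -
    ∫ s in (0:ℝ)..(1:ℝ), Complex.log (1 - (s : ℂ) * z) / (s : ℂ)

/-- `R(z; p, q) = 𝓡(z) + (πi/2)(p log(1-z) + q log z) - π²/6`. -/
def Rfun (z : ℂ) (p q : ℤ) : ℂ :=
  rogers z + (Cpi * I / 2) * (p * Complex.log (1 - z) + q * Complex.log z) - Cpi ^ 2 / 6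

/-- `R̂(z; 2p, 2q) = 𝓡(z) + πi(p log(1-z) + q log z) - π²/6`. -/
def Rhat (z : ℂ) (p q : ℤ) : ℂ :=
  rogers z + Cpi * I * (p * Complex.log (1 - z) + q * Complex.log z) - Cpi ^ 2 / 6

/-- `ℂ / π²ℤ`. -/
abbrev ModPiSq : Type := ℂ ⧸ AddSubgroup.zmultiples (Cpi ^ 2)

/-- `ℂ / 2π²ℤ`. -/
abbrev Mod2PiSq : Type := ℂ ⧸ AddSubgroup.zmultiples (2 * Cpi ^ 2)

abbrev RegT : Type := {z : ℂ // Reg z}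

def pbGen (z : ℂ) (h : Reg z) : FreeAbelianGroup RegT := FreeAbelianGroup.of ⟨z, h⟩

/-- The five term relators for the classical pre-Bloch group. -/
def pbRels : Set (FreeAbelianGroup RegT) :=
  {a | ∃ x y : ℂ, ∃ hx : Reg x, ∃ hy : Reg y, x ≠ y ∧
    ∃ h2 : Reg (y / x), ∃ h3 : Reg ((1 - x⁻¹) / (1 - y⁻¹)), ∃ h4 : Reg ((1 - x) / (1 - y)),
    a = pbGen x hx - pbGen y hy + pbGen (y / x) h2 -
        pbGen ((1 - x⁻¹) / (1 - y⁻¹)) h3 + pbGen ((1 - x) / (1 - y)) h4}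

def pbSub : AddSubgroup (FreeAbelianGroup RegT) := AddSubgroup.closure pbRels

/-- The classical pre-Bloch group `P(ℂ)`. -/
abbrev PreBloch : Type := FreeAbelianGroup RegT ⧸ pbSub

/-- The class `[z] ∈ P(ℂ)` (junk value `0` if `z ∈ {0,1}`). -/
def pbCls (z : ℂ) : PreBloch :=
  if h : Reg z then QuotientAddGroup.mk (pbGen z h) else 0

/-- `ℂ* ∧_ℤ ℂ*`, the second exterior power of the multiplicative group `ℂ*` as `ℤ`-module. -/
abbrev L2CU : Type := ↥(⋀[ℤ]^2 (Additive ℂˣ))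

/-- The wedge `a ∧ b ∈ ℂ* ∧_ℤ ℂ*`. -/
def wedgeU (a b : ℂˣ) : L2CU :=
  ⟨ExteriorAlgebra.ιMulti ℤ 2 ![Additive.ofMul a, Additive.ofMul b],
   ExteriorAlgebra.ιMulti_range ℤ 2 (Set.mem_range_self _)⟩

def nuPBFree : FreeAbelianGroup RegT →+ L2CU :=
  FreeAbelianGroup.lift fun z : RegT =>
    2 • wedgeU (Units.mk0 z.1 z.2.1) (Units.mk0 (1 - z.1) (sub_ne_zero_of_ne (Ne.symm z.2.2)))

/-- The homomorphism `P(ℂ) → ℂ* ∧_ℤ ℂ*`, `[z] ↦ 2 (z ∧ (1-z))`. -/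
def nuPB : PreBloch →+ L2CU :=
  if h : ∀ a ∈ pbSub, nuPBFree a = 0 then QuotientAddGroup.lift pbSub nuPBFree h else 0

/-- The classical Bloch group `B(ℂ)`. -/
def Bloch : AddSubgroup PreBloch := nuPB.ker

/-- The roots of unity in `ℂ*`. -/
def muStar : Set ℂˣ := {ζ | ∃ n : ℕ, 0 < n ∧ ζ ^ n = 1}

abbrev SL2C := Matrix.SpecialLinearGroup (Fin 2) ℂ

/-- `PSL(2,ℂ) = SL(2,ℂ)/{±1}` as a discrete group. -/
abbrev PSL2C := SL2C ⧸ Subgroup.center SL2C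

/-- The boundary map `C₃ → C₂` of the inhomogeneous bar complex computing `H₃(PSL(2,ℂ);ℤ)`. -/
def d3 : FreeAbelianGroup (Fin 3 → PSL2C) →+ FreeAbelianGroup (Fin 2 → PSL2C) :=
  FreeAbelianGroup.lift fun g =>
    FreeAbelianGroup.of ![g 1, g 2] - FreeAbelianGroup.of ![g 0 * g 1, g 2] +
      FreeAbelianGroup.of ![g 0, g 1 * g 2] - FreeAbelianGroup.of ![g 0, g 1]

/-- The boundary map `C₄ → C₃` of the inhomogeneous bar complex computing `H₃(PSL(2,ℂ);ℤ)`. -/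
def d4 : FreeAbelianGroup (Fin 4 → PSL2C) →+ FreeAbelianGroup (Fin 3 → PSL2C) :=
  FreeAbelianGroup.lift fun g =>
    FreeAbelianGroup.of ![g 1, g 2, g 3] - FreeAbelianGroup.of ![g 0 * g 1, g 2, g 3] +
      FreeAbelianGroup.of ![g 0, g 1 * g 2, g 3] - FreeAbelianGroup.of ![g 0, g 1, g 2 * g 3] +
      FreeAbelianGroup.of ![g 0, g 1, g 2]

/-- `H₃(PSL(2,ℂ);ℤ)`, defined as homology of the inhomogeneous bar complex. -/
abbrev H3PSL2C : Type := ↥d3.ker ⧸ ((d4.range).addSubgroupOf d3.ker)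

/-- The set of combinatorial flattenings. -/
def Flattenings : Set (ℂ × ℂ × ℂ) :=
  {w | w.1 + w.2.1 + w.2.2 = 0 ∧ ∃ z : ℂ, Reg z ∧ ∃ p q r : ℤ,
    w.1 = Complex.log z + p * (Cpi * I) ∧
    w.2.1 = -Complex.log (1 - z) + q * (Cpi * I) ∧
    w.2.2 = Complex.log (1 - z) - Complex.log z + r * (Cpi * I)}

/-- The map `ℓ : 𝓒 → ℂ³`. -/
def ellMap (w : ℂ × ℂ) : ℂ × ℂ × ℂ := (w.1, w.2, -w.1 - w.2)

/-- The element `κ = [x,1,1] + [x,0,0] - [x,1,0] - [x,0,1] ∈ êP'(ℂ)`. -/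
def kap (x : ℂ) : EPreBloch' := cls' x 1 1 + cls' x 0 0 - cls' x 1 0 - cls' x 0 1

/-- The natural projection `êP'(ℂ) → êP(ℂ)`. -/
def projP : EPreBloch' →+ EPreBloch :=
  QuotientAddGroup.map relSub' relSub (AddMonoidHom.id _)
    (by
      rw [AddSubgroup.comap_id]
      exact AddSubgroup.closure_mono Set.subset_union_left)

lemma exp_two_mul_intCast_Cpi (n : ℤ) : exp (2 * (n * (Cpi * I))) = 1 := by
  rw [Complex.exp_eq_one_iff]
  exact ⟨n, by simp only [Cpi]; ring⟩

lemma exp_two_mul_eq {a b : ℂ} (h : exp (2 * a) = exp (2 * b)) :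
    ∃ n : ℤ, a = b + n * (Cpi * I) := by
  obtain ⟨n, hn⟩ := Complex.exp_eq_exp_iff_exists_int.1 h
  refine ⟨n, ?_⟩
  simp only [Cpi]
  linear_combination hn / 2

lemma exp_two_mul_log {z : ℂ} (hz : z ≠ 0) : exp (2 * log z) = z ^ 2 := by
  rw [two_mul, Complex.exp_add, Complex.exp_log hz, sq]

lemma liesOver_iff {w : ℂ × ℂ} {z : ℂ} :
    LiesOver w z ↔ Reg z ∧ exp (2 * w.1) = z ^ 2 ∧ exp (2 * w.2) * (1 - z) ^ 2 = 1 := by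
  constructor
  · rintro ⟨hz, p, q, rfl⟩
    have h1 : 1 - z ≠ 0 := sub_ne_zero.2 hz.2.symm
    refine ⟨hz, ?_, ?_⟩
    · rw [pt, mul_add, Complex.exp_add, exp_two_mul_intCast_Cpi, exp_two_mul_log hz.1, mul_one]
    · rw [pt, mul_add, Complex.exp_add, exp_two_mul_intCast_Cpi, mul_one, mul_neg,
        Complex.exp_neg, exp_two_mul_log h1]
      exact inv_mul_cancel₀ (pow_ne_zero 2 h1)
  · rintro ⟨hz, ha, hb⟩
    have h1 : 1 - z ≠ 0 := sub_ne_zero.2 hz.2.symm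
    obtain ⟨p, hp⟩ := exp_two_mul_eq (ha.trans (exp_two_mul_log hz.1).symm)
    obtain ⟨q, hq⟩ : ∃ n : ℤ, w.2 = -log (1 - z) + n * (Cpi * I) := by
      apply exp_two_mul_eq
      rw [mul_neg, Complex.exp_neg, exp_two_mul_log h1]
      exact eq_inv_of_mul_eq_one_left hb
    exact ⟨hz, p, q, Prod.ext hp hq⟩

lemma LiesOver.mem_Cover {w : ℂ × ℂ} {z : ℂ} (h : LiesOver w z) : w ∈ Cover := by
  obtain ⟨hz, p, q, rfl⟩ := h
  exact pt_mem_Cover hz p q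

lemma LiesOver.covAct {w : ℂ × ℂ} {z : ℂ} (h : LiesOver w z) (v : ℤ × ℤ) :
    LiesOver (covAct v w) z := by
  rw [liesOver_iff] at h ⊢
  simp only [ExtendedBloch.covAct, mul_add, Complex.exp_add, exp_two_mul_intCast_Cpi, mul_one]
  exact h

lemma LiesOver.exists_covAct {w w' : ℂ × ℂ} {z : ℂ} (h : LiesOver w z) (h' : LiesOver w' z) :
    ∃ v : ℤ × ℤ, w' = ExtendedBloch.covAct v w := by
  obtain ⟨-, p, q, rfl⟩ := h
  obtain ⟨-, p', q', rfl⟩ := h'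
  refine ⟨(p' - p, q' - q), Prod.ext ?_ ?_⟩ <;>
  · simp only [pt, ExtendedBloch.covAct]
    push_cast
    ring

/-- The involution of `𝓒` covering `z ↦ 1 - z`. -/
def flip (w : ℂ × ℂ) : ℂ × ℂ := (-w.2, -w.1)

lemma Reg.one_sub {z : ℂ} (h : Reg z) : Reg (1 - z) :=
  ⟨sub_ne_zero.2 h.2.symm, fun e => h.1 (by linear_combination -e)⟩

lemma flip_pt (z : ℂ) (p q : ℤ) : flip (pt z p q) = pt (1 - z) (-q) (-p) := by
  refine Prod.ext ?_ ?_
  · simp only [flip, pt]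
    push_cast
    ring
  · simp only [flip, pt, sub_sub_cancel]
    push_cast
    ring

lemma LiesOver.flip {w : ℂ × ℂ} {z : ℂ} (h : LiesOver w z) :
    LiesOver (ExtendedBloch.flip w) (1 - z) := by
  obtain ⟨hz, p, q, rfl⟩ := h
  exact ⟨hz.one_sub, -q, -p, flip_pt z p q⟩

/-- The linear relations satisfied by the logarithmic coordinates of points of `𝓕𝓣̂`. -/
structure LogRel (w : Fin 5 → ℂ × ℂ) : Prop where
  fst_two : (w 2).1 = (w 1).1 - (w 0).1
  fst_three : (w 3).1 = (w 1).1 - (w 0).1 + (w 1).2 - (w 0).2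
  fst_four : (w 4).1 = (w 1).2 - (w 0).2
  snd_three : (w 3).2 = (w 2).2 - (w 1).2
  snd_four : (w 4).2 = (w 2).2 - (w 1).2 - (w 0).1

lemma one_sub_ftTuple_two {x y : ℂ} (hx : x ≠ 0) : 1 - y / x = (x - y) / x := by
  field_simp

lemma ftTuple_three_eq {x y : ℂ} (hx : Reg x) (hy : Reg y) :
    (1 - x⁻¹) / (1 - y⁻¹) = y / x * ((1 - x) / (1 - y)) := by
  have hx0 := hx.1
  have hy0 := hy.1
  have hy1 : 1 - y ≠ 0 := sub_ne_zero.2 hy.2.symm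
  have hy1' : y - 1 ≠ 0 := sub_ne_zero.2 hy.2
  have : 1 - y⁻¹ = (y - 1) / y := by field_simp
  have h' : 1 - x⁻¹ = (x - 1) / x := by field_simp
  rw [this, h']
  field_simp
  ring

lemma one_sub_ftTuple_three {x y : ℂ} (hx : Reg x) (hy : Reg y) :
    1 - (1 - x⁻¹) / (1 - y⁻¹) = (x - y) / (x * (1 - y)) := by
  rw [ftTuple_three_eq hx hy]
  have hx0 := hx.1
  have hy1 : 1 - y ≠ 0 := sub_ne_zero.2 hy.2.symm
  field_simp
  ring

lemma one_sub_ftTuple_four {x y : ℂ} (hy : Reg y) :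
    1 - (1 - x) / (1 - y) = (x - y) / (1 - y) := by
  have hy1 : 1 - y ≠ 0 := sub_ne_zero.2 hy.2.symm
  field_simp
  ring

lemma reg_ftTuple {x y : ℂ} (hx : Reg x) (hy : Reg y) (hxy : x ≠ y) (i : Fin 5) :
    Reg (ftTuple x y i) := by
  have hx1 : 1 - x ≠ 0 := sub_ne_zero.2 hx.2.symm
  have hy1 : 1 - y ≠ 0 := sub_ne_zero.2 hy.2.symm
  have hd : x - y ≠ 0 := sub_ne_zero.2 hxy
  have key : ∀ z : ℂ, z ≠ 0 → 1 - z ≠ 0 → Reg z := fun z h h' => ⟨h, (sub_ne_zero.1 h').symm⟩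
  fin_cases i
  · exact hx
  · exact hy
  · refine key (y / x) (div_ne_zero hy.1 hx.1) ?_
    rw [one_sub_ftTuple_two hx.1]
    exact div_ne_zero hd hx.1
  · refine key ((1 - x⁻¹) / (1 - y⁻¹)) ?_ ?_
    · rw [ftTuple_three_eq hx hy]
      exact mul_ne_zero (div_ne_zero hy.1 hx.1) (div_ne_zero hx1 hy1)
    · rw [one_sub_ftTuple_three hx hy]
      exact div_ne_zero hd (mul_ne_zero hx.1 hy1)
  · refine key ((1 - x) / (1 - y)) (div_ne_zero hx1 hy1) ?_
    rw [one_sub_ftTuple_four hy]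
    exact div_ne_zero hd hy1

lemma reg_base_left : Reg ((1 + I) / 4) := by
  constructor <;> intro h <;> simpa using congrArg Complex.im h

lemma reg_base_right : Reg I := by
  constructor <;> intro h <;> simpa using congrArg Complex.im h

lemma base_ne : (1 + I) / 4 ≠ I := by
  intro h
  simpa using congrArg Complex.re h

lemma basePt_mem_FTpre : basePt ∈ FTpre :=
  ⟨_, ⟨_, _, reg_base_left, reg_base_right, base_ne, rfl⟩, fun i =>
    ⟨reg_ftTuple reg_base_left reg_base_right base_ne i, 0, 0, rfl⟩⟩

lemma log_mul_of_re_pos {z w : ℂ} (hz : 0 < z.re) (hw : 0 < w.re) :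
    log (z * w) = log z + log w := by
  have hz0 : z ≠ 0 := by rintro rfl; simp at hz
  have hw0 : w ≠ 0 := by rintro rfl; simp at hw
  have h1 := abs_lt.1 (Complex.abs_arg_lt_pi_div_two_iff.2 (Or.inl hz))
  have h2 := abs_lt.1 (Complex.abs_arg_lt_pi_div_two_iff.2 (Or.inl hw))
  exact Complex.log_mul hz0 hw0 ⟨by linarith [h1.1, h2.1], by linarith [h1.2, h2.2]⟩

lemma logRel_basePt : LogRel basePt := by
  have e2 : I / ((1 + I) / 4) = 2 + 2 * I := by
    rw [div_eq_iff reg_base_left.1]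
    linear_combination -I_sq / 2
  have e4 : (1 - (1 + I) / 4) / (1 - I) = (2 + I) / 4 := by
    rw [div_eq_iff (sub_ne_zero.2 reg_base_right.2.symm)]
    linear_combination I_sq / 4
  have e3 : (1 - ((1 + I) / 4)⁻¹) / (1 - I⁻¹) = (1 + 3 * I) / 2 := by
    rw [ftTuple_three_eq reg_base_left reg_base_right, e2, e4]
    linear_combination I_sq / 2
  have l2 : log I = log (2 + 2 * I) + log ((1 + I) / 4) := by
    rw [← log_mul_of_re_pos (by simp) (by simp)]
    congr 1
    linear_combination -I_sq / 2
  have l4 : log (1 - (1 + I) / 4) = log ((2 + I) / 4) + log (1 - I) := by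
    rw [← log_mul_of_re_pos (by simp) (by simp)]
    congr 1
    linear_combination I_sq / 4
  have l3 : log ((1 + 3 * I) / 2) = log (2 + 2 * I) + log ((2 + I) / 4) := by
    rw [← log_mul_of_re_pos (by simp) (by simp)]
    congr 1
    linear_combination -I_sq / 2
  have m3 : log (1 - (2 + 2 * I)) = log (1 - (1 + 3 * I) / 2) + log (1 - I) := by
    rw [← log_mul_of_re_pos (by norm_num) (by simp)]
    congr 1
    linear_combination -3 * I_sq / 2
  have m4 : log (1 - (2 + I) / 4) = log (1 - (1 + 3 * I) / 2) + log ((1 + I) / 4) := by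
    rw [← log_mul_of_re_pos (by norm_num) (by simp)]
    congr 1
    linear_combination 3 * I_sq / 8
  simp only [inv_div, inv_I, sub_neg_eq_add] at e3
  constructor <;> simp [basePt, ftTuple, pt, e2, e3, e4]
  · linear_combination -l2
  · linear_combination l3 - l2 - l4
  · linear_combination -l4
  · linear_combination m3
  · linear_combination m3 - m4

lemma eq_zero_of_mem_FThat₀ {F : (Fin 5 → ℂ × ℂ) → ℂ} (hF : Continuous F)
    (hexp : ∀ w ∈ FTpre, exp (2 * F w) = 1) (h0 : F basePt = 0)
    {w : Fin 5 → ℂ × ℂ} (hw : w ∈ FThat₀) : F w = 0 := by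
  have hcount : (Set.range fun n : ℤ => (n : ℂ) * (Cpi * I)).Countable := Set.countable_range _
  have himg : F '' FThat₀ ⊆ Set.range fun n : ℤ => (n : ℂ) * (Cpi * I) := by
    rintro _ ⟨u, hu, rfl⟩
    obtain ⟨n, hn⟩ := exp_two_mul_eq (a := F u) (b := 0)
      (by simpa using hexp u (connectedComponentIn_subset _ _ hu))
    exact ⟨n, by simp [hn]⟩
  have hsub := hcount.isTotallyDisconnected _ himg
    (isPreconnected_connectedComponentIn.image F hF.continuousOn)
  rw [← h0]
  exact hsub (Set.mem_image_of_mem F hw)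
    (Set.mem_image_of_mem F (mem_connectedComponentIn basePt_mem_FTpre))

lemma logRel_of_mem_FThat₀ {w : Fin 5 → ℂ × ℂ} (hw : w ∈ FThat₀) : LogRel w := by
  have key : ∀ w ∈ FTpre, ∃ x y : ℂ, x ≠ 0 ∧ y ≠ 0 ∧ 1 - x ≠ 0 ∧ 1 - y ≠ 0 ∧ x - y ≠ 0 ∧
      exp (2 * (w 0).1) = x ^ 2 ∧ exp (2 * (w 0).2) = ((1 - x) ^ 2)⁻¹ ∧
      exp (2 * (w 1).1) = y ^ 2 ∧ exp (2 * (w 1).2) = ((1 - y) ^ 2)⁻¹ ∧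
      exp (2 * (w 2).1) = (y / x) ^ 2 ∧ exp (2 * (w 2).2) = (((x - y) / x) ^ 2)⁻¹ ∧
      exp (2 * (w 3).1) = (y / x * ((1 - x) / (1 - y))) ^ 2 ∧
      exp (2 * (w 3).2) = (((x - y) / (x * (1 - y))) ^ 2)⁻¹ ∧
      exp (2 * (w 4).1) = ((1 - x) / (1 - y)) ^ 2 ∧
      exp (2 * (w 4).2) = (((x - y) / (1 - y)) ^ 2)⁻¹ := by
    rintro w ⟨_, ⟨x, y, hx, hy, hxy, rfl⟩, h⟩
    have h' := fun i => (liesOver_iff.1 (h i)).2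
    refine ⟨x, y, hx.1, hy.1, sub_ne_zero.2 hx.2.symm, sub_ne_zero.2 hy.2.symm,
      sub_ne_zero.2 hxy, (h' 0).1, eq_inv_of_mul_eq_one_left (h' 0).2, (h' 1).1,
      eq_inv_of_mul_eq_one_left (h' 1).2, (h' 2).1, ?_, ?_, ?_, (h' 4).1, ?_⟩
    · rw [← one_sub_ftTuple_two hx.1]
      exact eq_inv_of_mul_eq_one_left (h' 2).2
    · rw [← ftTuple_three_eq hx hy]
      exact (h' 3).1
    · rw [← one_sub_ftTuple_three hx hy]
      exact eq_inv_of_mul_eq_one_left (h' 3).2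
    · rw [← one_sub_ftTuple_four hy]
      exact eq_inv_of_mul_eq_one_left (h' 4).2
  have hb := logRel_basePt
  constructor
  · refine sub_eq_zero.1 (eq_zero_of_mem_FThat₀ (F := fun w => (w 2).1 - ((w 1).1 - (w 0).1))
      (by fun_prop) (fun u hu => ?_) (sub_eq_zero.2 hb.fst_two) hw)
    obtain ⟨x, y, hx, hy, hx1, hy1, hd, a0, b0, a1, b1, a2, b2, a3, b3, a4, b4⟩ := key u hu
    simp only [mul_sub, Complex.exp_sub, a0, a1, a2]
    field_simp
  · refine sub_eq_zero.1 (eq_zero_of_mem_FThat₀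
      (F := fun w => (w 3).1 - ((w 1).1 - (w 0).1 + (w 1).2 - (w 0).2))
      (by fun_prop) (fun u hu => ?_) (sub_eq_zero.2 hb.fst_three) hw)
    obtain ⟨x, y, hx, hy, hx1, hy1, hd, a0, b0, a1, b1, a2, b2, a3, b3, a4, b4⟩ := key u hu
    simp only [mul_sub, mul_add, Complex.exp_sub, Complex.exp_add, a0, a1, b0, b1, a3]
    field_simp
  · refine sub_eq_zero.1 (eq_zero_of_mem_FThat₀ (F := fun w => (w 4).1 - ((w 1).2 - (w 0).2))
      (by fun_prop) (fun u hu => ?_) (sub_eq_zero.2 hb.fst_four) hw)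
    obtain ⟨x, y, hx, hy, hx1, hy1, hd, a0, b0, a1, b1, a2, b2, a3, b3, a4, b4⟩ := key u hu
    simp only [mul_sub, Complex.exp_sub, b0, b1, a4]
    field_simp
  · refine sub_eq_zero.1 (eq_zero_of_mem_FThat₀ (F := fun w => (w 3).2 - ((w 2).2 - (w 1).2))
      (by fun_prop) (fun u hu => ?_) (sub_eq_zero.2 hb.snd_three) hw)
    obtain ⟨x, y, hx, hy, hx1, hy1, hd, a0, b0, a1, b1, a2, b2, a3, b3, a4, b4⟩ := key u hu
    simp only [mul_sub, Complex.exp_sub, b1, b2, b3]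
    field_simp
  · refine sub_eq_zero.1 (eq_zero_of_mem_FThat₀
      (F := fun w => (w 4).2 - ((w 2).2 - (w 1).2 - (w 0).1))
      (by fun_prop) (fun u hu => ?_) (sub_eq_zero.2 hb.snd_four) hw)
    obtain ⟨x, y, hx, hy, hx1, hy1, hd, a0, b0, a1, b1, a2, b2, a3, b3, a4, b4⟩ := key u hu
    simp only [mul_sub, Complex.exp_sub, a0, b1, b2, b4]
    field_simp

/-- Path lifting: along a preconnected open set of parameters, membership in the image of
`𝓕𝓣̂₀ → FT` propagates. -/
lemma exists_lift_of_isPreconnected {s : Set ℂ} (hs : IsPreconnected s) (hso : IsOpen s)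
    {g : ℂ → Fin 5 → ℂ} (hg : ContinuousOn g s) (hFT : ∀ t ∈ s, g t ∈ FT)
    (hreg : ∀ t ∈ s, ∀ i, Reg (g t i)) {a b : ℂ} (ha : a ∈ s) (hb : b ∈ s)
    (hlift : ∃ w ∈ FThat₀, ∀ i, LiesOver (w i) (g a i)) :
    ∃ w ∈ FThat₀, ∀ i, LiesOver (w i) (g b i) := by
  let P : ℂ → ℂ → Prop := fun a b =>
    (∃ w ∈ FThat₀, ∀ i, LiesOver (w i) (g a i)) → ∃ w ∈ FThat₀, ∀ i, LiesOver (w i) (g b i)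
  refine hs.induction₂' P (fun c hc => ?_) (fun _ _ _ _ _ _ h h' => h' ∘ h) ha hb hlift
  have hgi : ∀ i, ContinuousOn (fun t => g t i) s := fun i => continuousOn_pi.1 hg i
  have hne : ∀ t ∈ s, ∀ i, g t i ≠ 0 ∧ 1 - g t i ≠ 0 := fun t ht i =>
    ⟨(hreg t ht i).1, sub_ne_zero.2 (hreg t ht i).2.symm⟩
  let O : Set ℂ := {t | t ∈ s ∧ ∀ i, g t i / g c i ∈ slitPlane ∧
    (1 - g t i) / (1 - g c i) ∈ slitPlane}
  have hO : O ∈ nhds c := by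
    have hsc : s ∈ nhds c := hso.mem_nhds hc
    have hca : ∀ i, ContinuousAt (fun t => g t i) c := fun i => (hgi i).continuousAt hsc
    refine Filter.inter_mem hsc (Filter.eventually_all.2 fun i => Filter.Eventually.and ?_ ?_)
    · refine ((hca i).div_const (g c i)).eventually_mem (isOpen_slitPlane.mem_nhds ?_)
      simp only [div_self (hne c hc i).1, one_mem_slitPlane]
    · refine (((hca i).const_sub 1).div_const (1 - g c i)).eventually_mem
        (isOpen_slitPlane.mem_nhds ?_)
      simp only [div_self (hne c hc i).2, one_mem_slitPlane]
  have hmain : ∀ u ∈ connectedComponentIn O c, ∀ v ∈ connectedComponentIn O c, P u v := by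
    rintro u hu v hv ⟨w, hw, hwu⟩
    have hNO := connectedComponentIn_subset O c
    let σ : ℂ → Fin 5 → ℂ × ℂ := fun t i =>
      ((w i).1 + (log (g t i / g c i) - log (g u i / g c i)),
        (w i).2 - (log ((1 - g t i) / (1 - g c i)) - log ((1 - g u i) / (1 - g c i))))
    have hσ : ∀ t ∈ connectedComponentIn O c, ∀ i, LiesOver (σ t i) (g t i) := by
      intro t ht i
      obtain ⟨hc0, hc1⟩ := hne c hc i
      obtain ⟨ht0, ht1⟩ := hne t (hNO ht).1 i
      obtain ⟨hu0, hu1⟩ := hne u (hNO hu).1 i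
      obtain ⟨-, e1, e2⟩ := liesOver_iff.1 (hwu i)
      have e2' := eq_inv_of_mul_eq_one_left e2
      refine liesOver_iff.2 ⟨hreg t (hNO ht).1 i, ?_, ?_⟩
      · simp only [σ, mul_add, mul_sub, Complex.exp_add, Complex.exp_sub, e1,
          exp_two_mul_log (div_ne_zero ht0 hc0), exp_two_mul_log (div_ne_zero hu0 hc0)]
        field_simp
      · simp only [σ, mul_sub, Complex.exp_sub, e2',
          exp_two_mul_log (div_ne_zero ht1 hc1), exp_two_mul_log (div_ne_zero hu1 hc1)]
        field_simp
    have hcont : ContinuousOn σ (connectedComponentIn O c) := by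
      have hgN : ∀ i, ContinuousOn (fun t => g t i) (connectedComponentIn O c) := fun i =>
        (hgi i).mono fun t ht => (hNO ht).1
      refine continuousOn_pi.2 fun i => ContinuousOn.prodMk ?_ ?_
      · exact continuousOn_const.add ((((hgN i).div_const _).clog
          fun t ht => ((hNO ht).2 i).1).sub continuousOn_const)
      · exact continuousOn_const.sub (((((continuousOn_const.sub (hgN i))).div_const _).clog
          fun t ht => ((hNO ht).2 i).2).sub continuousOn_const)
    have hσu : σ u = w := by
      funext i
      simp [σ]
    have hsub : σ '' connectedComponentIn O c ⊆ connectedComponentIn FTpre w := by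
      refine (isPreconnected_connectedComponentIn.image σ hcont).subset_connectedComponentIn
        ⟨u, hu, hσu⟩ ?_
      rintro _ ⟨t, ht, rfl⟩
      exact ⟨g t, hFT t (hNO ht).1, hσ t ht⟩
    refine ⟨σ v, ?_, hσ v hv⟩
    have hw' : w ∈ connectedComponentIn FTpre basePt := hw
    rw [FThat₀, connectedComponentIn_eq hw']
    exact hsub ⟨v, hv, rfl⟩
  have hcN : c ∈ connectedComponentIn O c := mem_connectedComponentIn (mem_of_mem_nhds hO)
  filter_upwards [nhdsWithin_le_nhds (connectedComponentIn_mem_nhds hO)] with y hy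
  exact ⟨hmain c hcN y hy, hmain y hy c hcN⟩

lemma finite_setOf_affine_eq_zero {a b : ℂ} (h : a ≠ 0) : {t : ℂ | a + t * b = 0}.Finite := by
  refine Set.Subsingleton.finite fun s hs t ht => ?_
  simp only [Set.mem_ofPred_eq] at hs ht
  have hb : b ≠ 0 := by
    rintro rfl
    simp [h] at hs
  exact mul_right_cancel₀ hb (by linear_combination hs - ht)

/-- The projection `𝓕𝓣̂₀ → FT` is surjective. -/
lemma exists_mem_FThat₀ {x y : ℂ} (hx : Reg x) (hy : Reg y) (hxy : x ≠ y) :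
    ∃ w ∈ FThat₀, ∀ i, LiesOver (w i) (ftTuple x y i) := by
  set x₀ : ℂ := (1 + I) / 4 with hx₀
  let X : ℂ → ℂ := fun t => x₀ + t * (x - x₀)
  let Y : ℂ → ℂ := fun t => I + t * (y - I)
  let B : Set ℂ := {t | x₀ + t * (x - x₀) = 0} ∪ {t | (1 - x₀) + t * -(x - x₀) = 0} ∪
    {t | I + t * (y - I) = 0} ∪ {t | (1 - I) + t * -(y - I) = 0} ∪
    {t | (x₀ - I) + t * ((x - x₀) - (y - I)) = 0}
  have hB : B.Finite :=
    ((((finite_setOf_affine_eq_zero reg_base_left.1).union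
      (finite_setOf_affine_eq_zero (sub_ne_zero.2 reg_base_left.2.symm))).union
      (finite_setOf_affine_eq_zero reg_base_right.1)).union
      (finite_setOf_affine_eq_zero (sub_ne_zero.2 reg_base_right.2.symm))).union
      (finite_setOf_affine_eq_zero (sub_ne_zero.2 base_ne))
  have hmem : ∀ t, t ∈ Bᶜ ↔ Reg (X t) ∧ Reg (Y t) ∧ X t ≠ Y t := by
    intro t
    have e1 : 1 - x₀ + t * -(x - x₀) = 1 - X t := by simp only [X]; ring
    have e2 : 1 - I + t * -(y - I) = 1 - Y t := by simp only [Y]; ring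
    have e3 : x₀ - I + t * ((x - x₀) - (y - I)) = X t - Y t := by simp only [X, Y]; ring
    simp only [B, Set.mem_compl_iff, Set.mem_union, Set.mem_ofPred_eq, not_or, e1, e2, e3, Reg,
      sub_eq_zero]
    change (((((¬ X t = 0) ∧ _) ∧ ¬ Y t = 0) ∧ _) ∧ _) ↔ _
    simp only [ne_eq, eq_comm (a := (1 : ℂ))]
    tauto
  have hX0 : X 0 = x₀ := by simp [X]
  have hY0 : Y 0 = I := by simp [Y]
  have hX1 : X 1 = x := by simp [X]
  have hY1 : Y 1 = y := by simp [Y]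
  have hcX : Continuous X := by fun_prop
  have hcY : Continuous Y := by fun_prop
  have hg : ContinuousOn (fun t => ftTuple (X t) (Y t)) Bᶜ := by
    have hX : ContinuousOn X Bᶜ := hcX.continuousOn
    have hY : ContinuousOn Y Bᶜ := hcY.continuousOn
    have hXn : ∀ t ∈ Bᶜ, X t ≠ 0 := fun t ht => ((hmem t).1 ht).1.1
    have hYn : ∀ t ∈ Bᶜ, Y t ≠ 0 := fun t ht => ((hmem t).1 ht).2.1.1
    have hYn1 : ∀ t ∈ Bᶜ, Y t ≠ 1 := fun t ht => ((hmem t).1 ht).2.1.2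
    refine continuousOn_pi.2 fun i => ?_
    fin_cases i
    · exact hX
    · exact hY
    · exact hY.div hX hXn
    · refine ContinuousOn.div (continuousOn_const.sub (hX.inv₀ hXn))
        (continuousOn_const.sub (hY.inv₀ hYn)) fun t ht => ?_
      rw [sub_ne_zero, ne_comm, ne_eq, inv_eq_one]
      exact hYn1 t ht
    · exact (continuousOn_const.sub hX).div (continuousOn_const.sub hY)
        fun t ht => sub_ne_zero.2 (hYn1 t ht).symm
  have hpre : IsPreconnected Bᶜ :=
    (hB.countable.isConnected_compl_of_one_lt_rank (by simp)).isPreconnected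
  have := exists_lift_of_isPreconnected (a := 0) (b := 1) hpre hB.isClosed.isOpen_compl hg
    (fun t ht => ⟨X t, Y t, ((hmem t).1 ht).1, ((hmem t).1 ht).2.1, ((hmem t).1 ht).2.2, rfl⟩)
    (fun t ht => reg_ftTuple ((hmem t).1 ht).1 ((hmem t).1 ht).2.1 ((hmem t).1 ht).2.2)
    ((hmem 0).2 (by rw [hX0, hY0]; exact ⟨reg_base_left, reg_base_right, base_ne⟩))
    ((hmem 1).2 (by rw [hX1, hY1]; exact ⟨hx, hy, hxy⟩))
    ⟨basePt, mem_connectedComponentIn basePt_mem_FTpre, fun i => by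
      simp only [hX0, hY0]
      exact ⟨reg_ftTuple reg_base_left reg_base_right base_ne i, 0, 0, rfl⟩⟩
  simpa only [hX1, hY1] using this

/-- Every choice of logarithmic coordinates over a point of `FT` that satisfies the linear
relations belongs to `𝓕𝓣̂`. -/
lemma mem_FThat {x y : ℂ} (hxy : x ≠ y) {u : Fin 5 → ℂ × ℂ} (hu : LogRel u)
    (h0 : LiesOver (u 0) x) (h1 : LiesOver (u 1) y) (h2 : LiesOver (u 2) (y / x)) :
    u ∈ FThat ∧ ∀ i, LiesOver (u i) (ftTuple x y i) := by
  obtain ⟨w, hw, hwl⟩ := exists_mem_FThat₀ h0.1 h1.1 hxy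
  have hr := logRel_of_mem_FThat₀ hw
  obtain ⟨⟨p₀, q₀⟩, e0⟩ := LiesOver.exists_covAct (hwl 0) h0
  obtain ⟨⟨p₁, q₁⟩, e1⟩ := LiesOver.exists_covAct (hwl 1) h1
  obtain ⟨⟨p₂, q₂⟩, e2⟩ := LiesOver.exists_covAct (hwl 2) h2
  have a0 := congrArg Prod.fst e0
  have b0 := congrArg Prod.snd e0
  have a1 := congrArg Prod.fst e1
  have b1 := congrArg Prod.snd e1
  have b2 := congrArg Prod.snd e2
  simp only [covAct] at a0 b0 a1 b1 b2
  let v : Fin 5 → ℤ × ℤ := ![(p₀, q₀), (p₁, q₁), (p₁ - p₀, q₂),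
    (p₁ - p₀ + q₁ - q₀, q₂ - q₁), (q₁ - q₀, q₂ - q₁ - p₀)]
  have huv : u = fun i => covAct (v i) (w i) := by
    funext i
    fin_cases i
    · exact e0
    · exact e1
    · refine Prod.ext ?_ b2
      change (u 2).1 = (w 2).1 + ((p₁ - p₀ : ℤ) : ℂ) * (Cpi * I)
      push_cast
      linear_combination hu.fst_two - hr.fst_two + a1 - a0
    · refine Prod.ext ?_ ?_
      · change (u 3).1 = (w 3).1 + ((p₁ - p₀ + q₁ - q₀ : ℤ) : ℂ) * (Cpi * I)
        push_cast
        linear_combination hu.fst_three - hr.fst_three + a1 - a0 + b1 - b0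
      · change (u 3).2 = (w 3).2 + ((q₂ - q₁ : ℤ) : ℂ) * (Cpi * I)
        push_cast
        linear_combination hu.snd_three - hr.snd_three + b2 - b1
    · refine Prod.ext ?_ ?_
      · change (u 4).1 = (w 4).1 + ((q₁ - q₀ : ℤ) : ℂ) * (Cpi * I)
        push_cast
        linear_combination hu.fst_four - hr.fst_four + b1 - b0
      · change (u 4).2 = (w 4).2 + ((q₂ - q₁ - p₀ : ℤ) : ℂ) * (Cpi * I)
        push_cast
        linear_combination hu.snd_four - hr.snd_four + b2 - b1 - a0
  refine ⟨⟨w, hw, v, ⟨p₀, p₁, q₀, q₁, q₂, rfl⟩, huv⟩, fun i => ?_⟩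
  rw [huv]
  exact (hwl i).covAct (v i)

/-- The class in `êP(ℂ)` of a point of `𝓒` (junk value `0` outside `𝓒`). -/
def coverCls (w : ℂ × ℂ) : EPreBloch :=
  if h : w ∈ Cover then QuotientAddGroup.mk (FreeAbelianGroup.of ⟨w, h⟩) else 0

lemma cls_eq_coverCls {z : ℂ} (h : Reg z) (p q : ℤ) : cls z p q = coverCls (pt z p q) := by
  rw [cls, coverCls, dif_pos h, dif_pos (pt_mem_Cover h p q), genOf]

lemma coverCls_five_term {u : Fin 5 → ℂ × ℂ} (hu : u ∈ FThat) (hc : ∀ i, u i ∈ Cover) :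
    coverCls (u 0) - coverCls (u 1) + coverCls (u 2) - coverCls (u 3) + coverCls (u 4) = 0 := by
  have hmem : ∑ i : Fin 5, (-1 : ℤ) ^ (i : ℕ) • FreeAbelianGroup.of (⟨u i, hc i⟩ : CoverT) ∈
      relSub := AddSubgroup.subset_closure (Or.inl ⟨u, hu, hc, rfl⟩)
  have h := (QuotientAddGroup.eq_zero_iff _).2 hmem
  simp only [Fin.sum_univ_five] at h
  simp only [coverCls, dif_pos (hc _)]
  rw [← h]
  simp only [← QuotientAddGroup.mk_add, ← QuotientAddGroup.mk_sub]
  congr 1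

lemma coverCls_add_flip_of_ne {x y : ℂ} {u v : ℂ × ℂ} (hu : LiesOver u x) (hv : LiesOver v y)
    (hxy : x ≠ y) :
    coverCls u + coverCls (flip u) = coverCls v + coverCls (flip v) := by
  have hr2 : Reg (y / x) := reg_ftTuple hu.1 hv.1 hxy 2
  obtain ⟨c, hc⟩ : ∃ c : ℂ, LiesOver (v.1 - u.1, c) (y / x) := by
    refine ⟨-log (1 - y / x), liesOver_iff.2 ⟨hr2, ?_, ?_⟩⟩
    · rw [mul_sub, Complex.exp_sub, (liesOver_iff.1 hu).2.1, (liesOver_iff.1 hv).2.1, div_pow]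
    · have h1 : 1 - y / x ≠ 0 := sub_ne_zero.2 hr2.2.symm
      rw [mul_neg, Complex.exp_neg, exp_two_mul_log h1]
      exact inv_mul_cancel₀ (pow_ne_zero 2 h1)
  let w : Fin 5 → ℂ × ℂ := ![u, v, (v.1 - u.1, c), (v.1 - u.1 + v.2 - u.2, c - v.2),
    (v.2 - u.2, c - v.2 - u.1)]
  let w' : Fin 5 → ℂ × ℂ := ![flip v, flip u, w 4, w 3, w 2]
  have hw : LogRel w := ⟨rfl, rfl, rfl, rfl, rfl⟩
  obtain ⟨hm, hl⟩ := mem_FThat hxy hw hu hv hc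
  have hw' : LogRel w' := by
    constructor <;> simp [w', w, flip] <;> ring
  have hxy' : 1 - y ≠ 1 - x := fun h => hxy (by linear_combination h)
  obtain ⟨hm', hl'⟩ := mem_FThat hxy' hw' hv.flip hu.flip (hl 4)
  have r := coverCls_five_term hm fun i => (hl i).mem_Cover
  have r' := coverCls_five_term hm' fun i => (hl' i).mem_Cover
  change coverCls u - coverCls v + coverCls (w 2) - coverCls (w 3) + coverCls (w 4) = 0 at r
  change coverCls (flip v) - coverCls (flip u) + coverCls (w 4) - coverCls (w 3) +
    coverCls (w 2) = 0 at r'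
  rw [← sub_eq_zero, ← sub_zero (0 : EPreBloch)]
  nth_rewrite 1 [← r]
  rw [← r']
  abel

lemma coverCls_add_flip {x y : ℂ} {u v : ℂ × ℂ} (hu : LiesOver u x) (hv : LiesOver v y) :
    coverCls u + coverCls (flip u) = coverCls v + coverCls (flip v) := by
  obtain ⟨z, hz⟩ := (Set.toFinite ({0, 1, x, y} : Set ℂ)).infinite_compl.nonempty
  simp only [Set.mem_compl_iff, Set.mem_insert_iff, Set.mem_singleton_iff, not_or] at hz
  have hw : LiesOver (pt z 0 0) z := ⟨⟨hz.1, hz.2.1⟩, 0, 0, rfl⟩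
  exact (coverCls_add_flip_of_ne hu hw (Ne.symm hz.2.2.1)).trans
    (coverCls_add_flip_of_ne hw hv hz.2.2.2)

/-- in `êP(ℂ)`, `[x,p,q] + [1-x,-q,-p] = 2[1/2,0,0]`. -/
theorem stmt15 (x : ℂ) (h0 : x ≠ 0) (h1 : x ≠ 1) (p q : ℤ) :
    cls x p q + cls (1 - x) (-q) (-p) = (2 : ℤ) • cls (1 / 2 : ℂ) 0 0 := by
  have hx : Reg x := ⟨h0, h1⟩
  have hh : Reg (1 / 2 : ℂ) := by constructor <;> norm_num
  have h := coverCls_add_flip (u := pt x p q) (v := pt (1 / 2) 0 0)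
    ⟨hx, p, q, rfl⟩ ⟨hh, 0, 0, rfl⟩
  have hhalf : (1 - 1 / 2 : ℂ) = 1 / 2 := by norm_num
  rw [flip_pt, flip_pt, hhalf, neg_zero] at h
  rw [cls_eq_coverCls hx, cls_eq_coverCls hx.one_sub, cls_eq_coverCls hh, h, two_zsmul]

end ExtendedBloch

end
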